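/- The Pfaffian form φ_X = Pf(dX · X⁻¹ · dX)/√(det X) on the space of positive definite symmetric 2n×2n real matrices is closed: dφ = 0. -/

import Mathlib

namespace PF

/-- The first element of the `k`-th pair `(2k, 2k+1)` in `Fin N`. -/
def lo {N : ℕ} (k : Fin (N / 2)) : Fin N := ⟨2 * k.1, by have := k.isLt; omega⟩

/-- The second element of the `k`-th pair `(2k, 2k+1)` in `Fin N`. -/
def hi {N : ℕ} (k : Fin (N / 2)) : Fin N := ⟨2 * k.1 + 1, by have := k.isLt; omega⟩

/-- A permutation is a canonical representative of a perfect matching if it is increasing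
within each pair and the pairs are listed by increasing smallest element.  Each perfect
matching of `{1, …, 2n}` has exactly one such representative, so that summing over these
permutations realizes the Pfaffian `Pf(M) = (1/(2^n n!)) ∑_{π ∈ S_{2n}} sgn π ·
M_{π(1)π(2)} ⋯ M_{π(2n-1)π(2n)}` without denominators. -/
def IsCanonicalMatching {N : ℕ} (σ : Equiv.Perm (Fin N)) : Prop :=
  (∀ k : Fin (N / 2), σ (lo k) < σ (hi k)) ∧
  (∀ k l : Fin (N / 2), k < l → σ (lo k) < σ (lo l))

open scoped Classical in
/-- The Pfaffian of a matrix, defined by the permutation-sum formula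
`Pf(M) = (1/(2^n n!)) ∑_{π ∈ S_{2n}} sgn π · M_{π(1)π(2)} ⋯ M_{π(2n-1)π(2n)}`,
realized as a sum over canonical representatives of perfect matchings so that it makes
sense over any (possibly noncommutative) ring.  For `N` odd (so `N/2` pairs do not
exhaust `Fin N`) no permutation is canonical in the relevant sense; the value is then
irrelevant for the statements below, which concern even sizes. -/
noncomputable def pfaffian {R : Type*} [Ring R] {N : ℕ} (M : Matrix (Fin N) (Fin N) R) : R :=
  ∑ σ : Equiv.Perm (Fin N),
    if IsCanonicalMatching σ then
      (Equiv.Perm.sign σ : ℤ) • (List.ofFn fun k : Fin (N / 2) => M (σ (lo k)) (σ (hi k))).prod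
    else 0

end PF

namespace PF

/-- The space of real `N × N` matrices. -/
abbrev MatN (N : ℕ) := Matrix (Fin N) (Fin N) ℝ

/-- The value of the Pfaffian differential form
`φ_X = Pf(dX · X⁻¹ · dX)/√(det X)` at the point `X`, evaluated on the tangent vectors
`v 0, …, v (N-1)` (matrices).  The entries of `dX · X⁻¹ · dX` are the 2-forms
`(u, w) ↦ (u X⁻¹ w − w X⁻¹ u)_{ab}`; the Pfaffian is expanded by the permutation-sum
formula `(1/(2^r r!)) ∑_π sgn π ∏ M_{π(2k-1)π(2k)}` with `r = N/2`, and the wedge product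
of the `r` 2-forms is evaluated by
`(ω₁∧…∧ω_r)(v₁,…,v_{2r}) = (1/2^r) ∑_τ sgn τ ∏_k ω_k(v_{τ(2k-1)}, v_{τ(2k)})`. -/
noncomputable def pfFormEval {N : ℕ} (X : MatN N) (v : Fin N → MatN N) : ℝ :=
  (Real.sqrt X.det)⁻¹ * ((2 : ℝ) ^ (N / 2) * (Nat.factorial (N / 2) : ℝ))⁻¹
    * ((2 : ℝ) ^ (N / 2))⁻¹ *
    ∑ π : Equiv.Perm (Fin N), ∑ τ : Equiv.Perm (Fin N),
      (((Equiv.Perm.sign π : ℤ) : ℝ) * ((Equiv.Perm.sign τ : ℤ) : ℝ)) *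
      ∏ k : Fin (N / 2),
        (v (τ (lo k)) * X⁻¹ * v (τ (hi k))
          - v (τ (hi k)) * X⁻¹ * v (τ (lo k))) (π (lo k)) (π (hi k))

/-- The two-form matrix attached to the `k`-th pair. -/
noncomputable def Mk {N : ℕ} (Y : MatN N) (g : Fin N → MatN N) (k : Fin (N / 2)) : MatN N :=
  g (lo k) * Y * g (hi k) - g (hi k) * Y * g (lo k)

/-- Alternating sum with the factor `l` replaced by `C`. -/
noncomputable def Wf {N : ℕ} (M : Fin (N / 2) → MatN N) (l : Fin (N / 2)) (C : MatN N) : ℝ :=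
  ∑ π : Equiv.Perm (Fin N), ((Equiv.Perm.sign π : ℤ) : ℝ) *
    ((∏ k ∈ Finset.univ.erase l, M k (π (lo k)) (π (hi k))) * C (π (lo l)) (π (hi l)))

/-- The alternating sum of the product. -/
noncomputable def Tf {N : ℕ} (M : Fin (N / 2) → MatN N) : ℝ :=
  ∑ π : Equiv.Perm (Fin N), ((Equiv.Perm.sign π : ℤ) : ℝ) *
    ∏ k, M k (π (lo k)) (π (hi k))

lemma lo_inj {N : ℕ} {k l : Fin (N / 2)} : (lo k : Fin N) = lo l ↔ k = l := by
  simp only [lo, Fin.ext_iff]; omega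
lemma hi_inj {N : ℕ} {k l : Fin (N / 2)} : (hi k : Fin N) = hi l ↔ k = l := by
  simp only [hi, Fin.ext_iff]; omega
lemma lo_ne_hi {N : ℕ} (k l : Fin (N / 2)) : (lo k : Fin N) ≠ hi l := by
  simp only [hi, lo, ne_eq, Fin.ext_iff]; omega

lemma Wf_add {N : ℕ} (M : Fin (N / 2) → MatN N) (l) (C D : MatN N) :
    Wf M l (C + D) = Wf M l C + Wf M l D := by
  simp [Wf, mul_add, Finset.sum_add_distrib]

lemma Wf_smul {N : ℕ} (M : Fin (N / 2) → MatN N) (l) (r : ℝ) (C : MatN N) :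
    Wf M l (r • C) = r * Wf M l C := by
  simp only [Wf, Matrix.smul_apply, smul_eq_mul, Finset.mul_sum]
  exact Finset.sum_congr rfl fun _ _ => by ring

lemma Wf_neg {N : ℕ} (M : Fin (N / 2) → MatN N) (l) (C : MatN N) :
    Wf M l (-C) = - Wf M l C := by
  simp [Wf]

lemma Wf_sub {N : ℕ} (M : Fin (N / 2) → MatN N) (l) (C D : MatN N) :
    Wf M l (C - D) = Wf M l C - Wf M l D := by
  rw [sub_eq_add_neg, Wf_add, Wf_neg, sub_eq_add_neg]

lemma Wf_congr {N : ℕ} {M M' : Fin (N / 2) → MatN N} {l} (C : MatN N)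
    (h : ∀ k, k ≠ l → M k = M' k) : Wf M l C = Wf M' l C := by
  unfold Wf
  refine Finset.sum_congr rfl fun π _ => ?_
  rw [Finset.prod_congr rfl]
  intro k hk
  rw [h k (Finset.ne_of_mem_erase hk)]

/-- The trace identity for alternating sums of tensors. -/
lemma trace_tensor {N : ℕ} (A : MatN N) (T : (Fin N → Fin N) → ℝ) :
    ∑ π : Equiv.Perm (Fin N), ((Equiv.Perm.sign π : ℤ) : ℝ) *
      ∑ j, ∑ c, A (π j) c * T (Function.update π j c)
    = A.trace * ∑ π : Equiv.Perm (Fin N), ((Equiv.Perm.sign π : ℤ) : ℝ) * T π := by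
  have h1 : ∀ π : Equiv.Perm (Fin N), ∑ j, ∑ c, A (π j) c * T (Function.update π j c)
      = A.trace * T π + ∑ j, ∑ i, if i = j then 0 else
          A (π j) (π i) * T (Function.update π j (π i)) := by
    intro π
    have ht : A.trace = ∑ j, A (π j) (π j) := by
      rw [Matrix.trace, ← Equiv.sum_comp π]; rfl
    rw [ht, Finset.sum_mul, ← Finset.sum_add_distrib]
    refine Finset.sum_congr rfl fun j _ => ?_
    rw [← Equiv.sum_comp π, ← Finset.add_sum_erase _ _ (Finset.mem_univ j),
      ← Finset.add_sum_erase (a := j) _ (fun i => if i = j then (0:ℝ) else _) (Finset.mem_univ j)]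
    simp only [Function.update_eq_self, if_true, zero_add]
    congr 1
    refine Finset.sum_congr rfl fun i hi => ?_
    rw [if_neg (Finset.ne_of_mem_erase hi)]
  simp_rw [h1, mul_add, Finset.sum_add_distrib]
  have h2 : ∑ π : Equiv.Perm (Fin N), ((Equiv.Perm.sign π : ℤ) : ℝ) *
      (∑ j, ∑ i, if i = j then 0 else
          A (π j) (π i) * T (Function.update π j (π i))) = 0 := by
    set G : Fin N → Fin N → ℝ := fun j i => ∑ π : Equiv.Perm (Fin N),
      ((Equiv.Perm.sign π : ℤ) : ℝ) * (if i = j then 0 else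
          A (π j) (π i) * T (Function.update π j (π i))) with hG
    have hanti : ∀ j i, G i j = - G j i := by
      intro j i
      simp only [hG]
      by_cases hij : i = j
      · simp [hij]
      rw [← Equiv.sum_comp (Equiv.mulRight (Equiv.swap i j)), ← Finset.sum_neg_distrib]
      refine Finset.sum_congr rfl fun π _ => ?_
      have hu : Function.update (⇑(π * Equiv.swap i j)) i (π i) = Function.update π j (π i) := by
        funext x
        by_cases hx : x = i
        · subst hx; simp [Function.update_of_ne hij]
        · by_cases hx' : x = j
          · subst hx'; simp [Function.update_of_ne hx]
          · simp [Function.update_of_ne hx, Function.update_of_ne hx',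
              Equiv.swap_apply_of_ne_of_ne hx hx']
      simp only [Equiv.coe_mulRight, Equiv.Perm.sign_mul, Equiv.Perm.sign_swap hij,
        Equiv.Perm.mul_apply, Equiv.swap_apply_left, Equiv.swap_apply_right, hu,
        if_neg hij, if_neg (Ne.symm hij)]
      simp
    have hs : ∑ j, ∑ i, G j i = 0 := by
      have : ∑ j, ∑ i, G j i = - ∑ j, ∑ i, G j i := by
        conv_lhs => rw [Finset.sum_comm]
        simp_rw [← Finset.sum_neg_distrib]
        exact Finset.sum_congr rfl fun j _ => Finset.sum_congr rfl fun i _ => hanti _ _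
      linarith
    refine Eq.trans ?_ hs
    simp only [hG, Finset.mul_sum]
    rw [Finset.sum_comm]
    refine Finset.sum_congr rfl fun j _ => ?_
    rw [Finset.sum_comm]
  rw [h2, add_zero, Finset.mul_sum]
  exact Finset.sum_congr rfl fun _ _ => by ring

lemma sum_pairs {m : ℕ} (f : Fin (2 * m) → ℝ) :
    ∑ j, f j = ∑ k : Fin (2 * m / 2), (f (lo k) + f (hi k)) := by
  rw [Finset.sum_add_distrib]
  have hb : Function.Bijective
      (Sum.elim lo hi : Fin (2 * m / 2) ⊕ Fin (2 * m / 2) → Fin (2 * m)) := by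
    rw [Fintype.bijective_iff_injective_and_card]
    constructor
    · rintro (k | k) (l | l) h
      · exact congrArg _ (lo_inj.1 h)
      · exact absurd h (lo_ne_hi k l)
      · exact absurd h.symm (lo_ne_hi l k)
      · exact congrArg _ (hi_inj.1 h)
    · simp only [Fintype.card_sum, Fintype.card_fin]
      omega
  rw [← Fintype.sum_bijective _ hb (fun x => f (Sum.elim lo hi x)) f (fun _ => rfl),
    Fintype.sum_sum_type]
  rfl

lemma trace_pf {m : ℕ} (A : MatN (2 * m)) (M : Fin (2 * m / 2) → MatN (2 * m)) :
    A.trace * Tf M = ∑ l, Wf M l (A * M l + M l * A.transpose) := by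
  have key := trace_tensor A (fun f => ∏ k, M k (f (lo k)) (f (hi k)))
  unfold Tf
  rw [← key]
  unfold Wf
  rw [Finset.sum_comm]
  refine Finset.sum_congr rfl fun π _ => ?_
  rw [sum_pairs, Finset.mul_sum]
  refine Finset.sum_congr rfl fun l _ => ?_
  congr 1
  rw [Matrix.add_apply, Matrix.mul_apply, Matrix.mul_apply, mul_add, Finset.mul_sum,
    Finset.mul_sum]
  congr 1
  · refine Finset.sum_congr rfl fun c _ => ?_
    rw [← Finset.mul_prod_erase _ _ (Finset.mem_univ l)]
    rw [Finset.prod_congr rfl (g := fun k => M k (π (lo k)) (π (hi k)))]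
    · simp [Function.update_of_ne (lo_ne_hi l l).symm]; ring
    · intro k hk
      have hk := Finset.ne_of_mem_erase hk
      rw [Function.update_of_ne (by simpa [lo_inj] using hk),
        Function.update_of_ne (lo_ne_hi _ _).symm]
  · refine Finset.sum_congr rfl fun c _ => ?_
    rw [← Finset.mul_prod_erase _ _ (Finset.mem_univ l)]
    rw [Finset.prod_congr rfl (g := fun k => M k (π (lo k)) (π (hi k)))]
    · simp [Function.update_of_ne (lo_ne_hi l l)]; ring
    · intro k hk
      have hk := Finset.ne_of_mem_erase hk
      rw [Function.update_of_ne (lo_ne_hi _ _), 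
        Function.update_of_ne (by simpa [hi_inj] using hk)]

lemma sum_perm_succ {n : ℕ} (H : Equiv.Perm (Fin (n + 1)) → ℝ) :
    ∑ i : Fin (n + 1), ∑ τ : Equiv.Perm (Fin n),
      H (i.cycleRange.symm * Equiv.Perm.decomposeFin.symm (0, τ)) = ∑ σ, H σ := by
  rw [← Fintype.sum_prod_type' (f := fun (i : Fin (n+1)) (τ : Equiv.Perm (Fin n)) =>
    H (i.cycleRange.symm * Equiv.Perm.decomposeFin.symm (0, τ)))]
  refine Fintype.sum_bijective (fun p : Fin (n + 1) × Equiv.Perm (Fin n) =>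
    (p.1.cycleRange.symm * Equiv.Perm.decomposeFin.symm (0, p.2) : Equiv.Perm (Fin (n+1))))
    ?_ _ _ (fun _ => rfl)
  rw [Fintype.bijective_iff_injective_and_card]
  constructor
  · rintro ⟨i, τ⟩ ⟨j, ρ⟩ h
    simp only at h
    have h0 := Equiv.congr_fun h 0
    simp at h0
    subst h0
    have := Equiv.Perm.decomposeFin.symm.injective (mul_left_cancel h)
    simpa using this
  · rw [Fintype.card_prod, Fintype.card_perm, Fintype.card_perm]
    simp [Nat.factorial_succ]

lemma reindex_sum {n : ℕ} {V : Type*} (v : Fin (n + 1) → V) (H : V → (Fin n → V) → ℝ) :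
    ∑ i : Fin (n + 1), (-1 : ℝ) ^ (i : ℕ) * ∑ τ : Equiv.Perm (Fin n),
      ((Equiv.Perm.sign τ : ℤ) : ℝ) * H (v i) (fun j => v (i.succAbove (τ j)))
    = ∑ σ : Equiv.Perm (Fin (n + 1)), ((Equiv.Perm.sign σ : ℤ) : ℝ) *
        H (v (σ 0)) (fun j => v (σ j.succ)) := by
  rw [← sum_perm_succ]
  refine Finset.sum_congr rfl fun i _ => ?_
  rw [Finset.mul_sum]
  refine Finset.sum_congr rfl fun τ _ => ?_
  simp [Fin.sign_cycleRange, Equiv.Perm.decomposeFin.symm_sign, mul_assoc, Equiv.Perm.sign_symm]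

/-- alternating sum of a triple product in slot `l` -/
noncomputable def tri {m : ℕ} (Y : MatN (2 * m)) (v : Fin (2 * m + 1) → MatN (2 * m))
    (l : Fin (2 * m / 2)) (a b c : Fin (2 * m + 1)) : ℝ :=
  ∑ σ : Equiv.Perm (Fin (2 * m + 1)), ((Equiv.Perm.sign σ : ℤ) : ℝ) *
    Wf (Mk Y fun j => v (σ j.succ)) l (v (σ a) * Y * v (σ b) * Y * v (σ c))

lemma tri_swap {m : ℕ} (Y : MatN (2 * m)) (v : Fin (2 * m + 1) → MatN (2 * m))
    (l : Fin (2 * m / 2)) (a b c x y : Fin (2 * m + 1)) (hxy : x ≠ y)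
    (hx : x = 0 ∨ x = (lo l).succ ∨ x = (hi l).succ)
    (hy : y = 0 ∨ y = (lo l).succ ∨ y = (hi l).succ) :
    tri Y v l (Equiv.swap x y a) (Equiv.swap x y b) (Equiv.swap x y c) = - tri Y v l a b c := by
  unfold tri
  conv_rhs => rw [← Equiv.sum_comp (Equiv.mulRight (Equiv.swap x y))]
  rw [← Finset.sum_neg_distrib]
  refine Finset.sum_congr rfl fun σ _ => ?_
  simp only [Equiv.coe_mulRight, Equiv.Perm.sign_mul, Equiv.Perm.sign_swap hxy,
    Equiv.Perm.mul_apply]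
  rw [Wf_congr (M' := Mk Y fun j => v (σ (Equiv.swap x y j.succ)))]
  · simp
  · intro k hk
    have e1 : Equiv.swap x y (lo k).succ = (lo k).succ := by
      apply Equiv.swap_apply_of_ne_of_ne
      · rcases hx with h | h | h <;> rw [h]
        · exact Fin.succ_ne_zero _
        · simpa [lo_inj] using hk
        · simpa using lo_ne_hi _ _
      · rcases hy with h | h | h <;> rw [h]
        · exact Fin.succ_ne_zero _
        · simpa [lo_inj] using hk
        · simpa using lo_ne_hi _ _
    have e2 : Equiv.swap x y (hi k).succ = (hi k).succ := by
      apply Equiv.swap_apply_of_ne_of_ne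
      · rcases hx with h | h | h <;> rw [h]
        · exact Fin.succ_ne_zero _
        · simpa using (lo_ne_hi _ _).symm
        · simpa [hi_inj] using hk
      · rcases hy with h | h | h <;> rw [h]
        · exact Fin.succ_ne_zero _
        · simpa using (lo_ne_hi _ _).symm
        · simpa [hi_inj] using hk
    simp only [Mk, e1, e2]

/-- The logarithmic derivative of the form, before antisymmetrisation. -/
noncomputable def Hf {m : ℕ} (Y z : MatN (2 * m)) (g : Fin (2 * m) → MatN (2 * m)) : ℝ :=
  -(1 / 2) * (z * Y).trace * Tf (Mk Y g) +
    ∑ l, Wf (Mk Y g) l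
      (-(g (lo l) * Y * z * Y * g (hi l) - g (hi l) * Y * z * Y * g (lo l)))

lemma alg_identity {m : ℕ} (Y : MatN (2 * m)) (hY : Y.IsSymm)
    (v : Fin (2 * m + 1) → MatN (2 * m)) (hv : ∀ i, (v i).IsSymm) :
    ∑ σ : Equiv.Perm (Fin (2 * m + 1)), ((Equiv.Perm.sign σ : ℤ) : ℝ) *
        Hf Y (v (σ 0)) (fun j => v (σ j.succ)) = 0 := by
  have h1 : ∀ σ : Equiv.Perm (Fin (2 * m + 1)), Hf Y (v (σ 0)) (fun j => v (σ j.succ)) =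
      ∑ l, (-(1/2) * (
        Wf (Mk Y fun j => v (σ j.succ)) l (v (σ 0) * Y * v (σ (lo l).succ) * Y * v (σ (hi l).succ))
        - Wf (Mk Y fun j => v (σ j.succ)) l (v (σ 0) * Y * v (σ (hi l).succ) * Y * v (σ (lo l).succ))
        + Wf (Mk Y fun j => v (σ j.succ)) l (v (σ (lo l).succ) * Y * v (σ (hi l).succ) * Y * v (σ 0))
        - Wf (Mk Y fun j => v (σ j.succ)) l (v (σ (hi l).succ) * Y * v (σ (lo l).succ) * Y * v (σ 0)))
        - Wf (Mk Y fun j => v (σ j.succ)) l (v (σ (lo l).succ) * Y * v (σ 0) * Y * v (σ (hi l).succ))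
        + Wf (Mk Y fun j => v (σ j.succ)) l (v (σ (hi l).succ) * Y * v (σ 0) * Y * v (σ (lo l).succ))) := by
    intro σ
    unfold Hf
    rw [mul_assoc, trace_pf, Finset.mul_sum, ← Finset.sum_add_distrib]
    refine Finset.sum_congr rfl fun l _ => ?_
    have ht : (v (σ 0) * Y).transpose = Y * v (σ 0) := by
      rw [Matrix.transpose_mul, hY.eq, (hv _).eq]
    rw [ht]
    have e : v (σ 0) * Y * Mk Y (fun j => v (σ j.succ)) l
        + Mk Y (fun j => v (σ j.succ)) l * (Y * v (σ 0))
      = v (σ 0) * Y * v (σ (lo l).succ) * Y * v (σ (hi l).succ)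
        - v (σ 0) * Y * v (σ (hi l).succ) * Y * v (σ (lo l).succ)
        + v (σ (lo l).succ) * Y * v (σ (hi l).succ) * Y * v (σ 0)
        - v (σ (hi l).succ) * Y * v (σ (lo l).succ) * Y * v (σ 0) := by
      unfold Mk
      noncomm_ring
    rw [e]
    simp only [Wf_add, Wf_sub, Wf_neg]
    ring
  simp_rw [h1, Finset.mul_sum]
  rw [Finset.sum_comm]
  refine Finset.sum_eq_zero fun l _ => ?_
  have n1 : (0 : Fin (2 * m + 1)) ≠ (lo l).succ := (Fin.succ_ne_zero _).symm
  have n2 : (0 : Fin (2 * m + 1)) ≠ (hi l).succ := (Fin.succ_ne_zero _).symm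
  have n3 : (lo l : Fin (2 * m)).succ ≠ (hi l).succ := by simpa using lo_ne_hi l l
  have t1 : tri Y v l 0 (hi l).succ (lo l).succ = - tri Y v l 0 (lo l).succ (hi l).succ := by
    rw [← tri_swap Y v l 0 (lo l).succ (hi l).succ (lo l).succ (hi l).succ n3 (by simp) (by simp),
      Equiv.swap_apply_left, Equiv.swap_apply_right, Equiv.swap_apply_of_ne_of_ne n1 n2]
  have t2 : tri Y v l (lo l).succ 0 (hi l).succ = - tri Y v l 0 (lo l).succ (hi l).succ := by
    rw [← tri_swap Y v l 0 (lo l).succ (hi l).succ 0 (lo l).succ n1 (by simp) (by simp),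
      Equiv.swap_apply_left, Equiv.swap_apply_right, Equiv.swap_apply_of_ne_of_ne n2.symm n3.symm]
  have t3 : tri Y v l (hi l).succ (lo l).succ 0 = - tri Y v l 0 (lo l).succ (hi l).succ := by
    rw [← tri_swap Y v l 0 (lo l).succ (hi l).succ 0 (hi l).succ n2 (by simp) (by simp),
      Equiv.swap_apply_left, Equiv.swap_apply_right, Equiv.swap_apply_of_ne_of_ne n1.symm n3]
  have t4 : tri Y v l (lo l).succ (hi l).succ 0 = - tri Y v l (hi l).succ (lo l).succ 0 := by
    rw [← tri_swap Y v l (hi l).succ (lo l).succ 0 (lo l).succ (hi l).succ n3 (by simp) (by simp),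
      Equiv.swap_apply_left, Equiv.swap_apply_right, Equiv.swap_apply_of_ne_of_ne n1 n2]
  have t5 : tri Y v l (hi l).succ 0 (lo l).succ = - tri Y v l (lo l).succ 0 (hi l).succ := by
    rw [← tri_swap Y v l (lo l).succ 0 (hi l).succ (lo l).succ (hi l).succ n3 (by simp) (by simp),
      Equiv.swap_apply_left, Equiv.swap_apply_right, Equiv.swap_apply_of_ne_of_ne n1 n2]
  have tot : -(1/2) * (tri Y v l 0 (lo l).succ (hi l).succ - tri Y v l 0 (hi l).succ (lo l).succ
      + tri Y v l (lo l).succ (hi l).succ 0 - tri Y v l (hi l).succ (lo l).succ 0)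
      - tri Y v l (lo l).succ 0 (hi l).succ + tri Y v l (hi l).succ 0 (lo l).succ = 0 := by
    rw [t5, t4, t3, t2, t1]; ring
  rw [← tot]
  unfold tri
  simp only [← Finset.sum_add_distrib, ← Finset.sum_sub_distrib, Finset.mul_sum]
  exact Finset.sum_congr rfl fun σ _ => by ring

lemma hasDerivAt_det_line {N : ℕ} (X w : MatN N) (hX : IsUnit X.det) :
    HasDerivAt (fun t : ℝ => (X + t • w).det) (X.det * (w * X⁻¹).trace) 0 := by
  have h := ((Matrix.det (1 + (Polynomial.X : Polynomial ℝ) •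
    (w * X⁻¹).map Polynomial.C)).hasDerivAt 0).const_mul X.det
  rw [Matrix.derivative_det_one_add_X_smul] at h
  refine h.congr_of_eventuallyEq (Filter.Eventually.of_forall fun t => ?_)
  have e : X + t • w = (1 + t • (w * X⁻¹)) * X := by
    rw [add_mul, one_mul, Matrix.smul_mul, Matrix.mul_assoc, Matrix.nonsing_inv_mul _ hX,
      Matrix.mul_one]
  simp only
  rw [e, Matrix.det_mul, mul_comm, ← Polynomial.coe_evalRingHom, RingHom.map_det]
  congr 2
  ext a b
  by_cases hab : a = b <;> simp [hab, -Matrix.map_mul, mul_comm t]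

lemma hasDerivAt_ringInverse_line {R : Type*} [NormedRing R] [HasSummableGeomSeries R]
    [NormedAlgebra ℝ R] (x : Rˣ) (w : R) :
    HasDerivAt (fun t : ℝ => Ring.inverse ((x : R) + t • w))
      (-((↑x⁻¹ : R) * w * (↑x⁻¹ : R))) 0 := by
  have h1 : HasDerivAt (fun t : ℝ => (x : R) + t • w) w 0 := by
    have := ((hasDerivAt_id (0 : ℝ)).smul_const w).const_add (x : R)
    rw [one_smul] at this
    exact this
  have h2 := hasFDerivAt_ringInverse (𝕜 := ℝ) x
  have h3 : HasFDerivAt Ring.inverse (-ContinuousLinearMap.mulLeftRight ℝ R ↑x⁻¹ ↑x⁻¹)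
      ((fun t : ℝ => (x : R) + t • w) 0) := by simpa using h2
  have h4 := h3.comp_hasDerivAt (0 : ℝ) h1
  exact h4.congr_deriv (by simp)

lemma hasDerivAt_inv_line {N : ℕ} (X w : MatN N) (hX : IsUnit X.det) (a b : Fin N) :
    HasDerivAt (fun t : ℝ => (X + t • w)⁻¹ a b) ((-(X⁻¹ * w * X⁻¹)) a b) 0 := by
  let _ : NormedRing (MatN N) := Matrix.linftyOpNormedRing
  let _ : NormedAlgebra ℝ (MatN N) := Matrix.linftyOpNormedAlgebra
  have hXu : IsUnit X := (Matrix.isUnit_iff_isUnit_det X).2 hX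
  obtain ⟨x, rfl⟩ := hXu
  have h3 := hasDerivAt_ringInverse_line x w
  have h4 := (LinearMap.toContinuousLinearMap
    (Matrix.entryLinearMap ℝ ℝ a b : MatN N →ₗ[ℝ] ℝ)).hasFDerivAt.comp_hasDerivAt (0 : ℝ) h3
  have e : (fun t : ℝ => ((x : MatN N) + t • w)⁻¹ a b) = fun t : ℝ =>
      (Ring.inverse ((x : MatN N) + t • w)) a b := by
    funext t
    rw [Matrix.nonsing_inv_eq_ringInverse]
  rw [e, ← Matrix.coe_units_inv]
  exact h4

lemma hasDerivAt_sandwich {N : ℕ} (X w P Q : MatN N) (hX : IsUnit X.det) (a b : Fin N) :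
    HasDerivAt (fun t : ℝ => (P * (X + t • w)⁻¹ * Q) a b) ((-(P * X⁻¹ * w * X⁻¹ * Q)) a b) 0 := by
  have e : (-(P * X⁻¹ * w * X⁻¹ * Q)) = P * (-(X⁻¹ * w * X⁻¹)) * Q := by noncomm_ring
  rw [e]
  simp only [Matrix.mul_apply, Finset.sum_mul]
  refine HasDerivAt.fun_sum fun i _ => HasDerivAt.fun_sum fun j _ => ?_
  exact ((hasDerivAt_inv_line X w hX j i).const_mul _).mul_const _

lemma hasDerivAt_pf {m : ℕ} (X w : MatN (2 * m)) (hX : 0 < X.det)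
    (u : Fin (2 * m) → MatN (2 * m)) :
    HasDerivAt (fun t : ℝ => pfFormEval (X + t • w) u)
      ((Real.sqrt X.det)⁻¹ * ((2 : ℝ) ^ (2 * m / 2) * (Nat.factorial (2 * m / 2) : ℝ))⁻¹
    * ((2 : ℝ) ^ (2 * m / 2))⁻¹ * ∑ τ : Equiv.Perm (Fin (2 * m)),
      ((Equiv.Perm.sign τ : ℤ) : ℝ) * Hf X⁻¹ w (fun j => u (τ j))) 0 := by
  have hU : IsUnit X.det := hX.ne'.isUnit
  have hT : ∀ g : Fin (2 * m) → MatN (2 * m),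
      HasDerivAt (fun t : ℝ => Tf (Mk (X + t • w)⁻¹ g)) (∑ l, Wf (Mk X⁻¹ g) l
      (-(g (lo l) * X⁻¹ * w * X⁻¹ * g (hi l) - g (hi l) * X⁻¹ * w * X⁻¹ * g (lo l)))) 0 := by
    intro g
    unfold Wf
    rw [Finset.sum_comm]
    simp only [← Finset.mul_sum]
    unfold Tf
    refine HasDerivAt.fun_sum fun π _ => HasDerivAt.const_mul _ ?_
    have := HasDerivAt.fun_finsetProd (u := (Finset.univ : Finset (Fin (2 * m / 2)))) (x := (0:ℝ))
      (f := fun k t => Mk (X + t • w)⁻¹ g k (π (lo k)) (π (hi k)))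
      (f' := fun l => (-(g (lo l) * X⁻¹ * w * X⁻¹ * g (hi l)
        - g (hi l) * X⁻¹ * w * X⁻¹ * g (lo l))) (π (lo l)) (π (hi l))) (by
        intro k _
        have := (hasDerivAt_sandwich X w (g (lo k)) (g (hi k)) hU (π (lo k)) (π (hi k))).sub
          (hasDerivAt_sandwich X w (g (hi k)) (g (lo k)) hU (π (lo k)) (π (hi k)))
        refine this.congr_deriv ?_
        simp only [Matrix.neg_apply, Matrix.sub_apply]
        ring)
    simpa using this
  have hS : HasDerivAt (fun t : ℝ => (Real.sqrt (X + t • w).det)⁻¹)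
      ((Real.sqrt X.det)⁻¹ * (-(1 / 2) * (w * X⁻¹).trace)) 0 := by
    have h := ((hasDerivAt_det_line X w hU).sqrt (by simpa using hX.ne')).inv
      (by simpa using (Real.sqrt_pos.2 hX).ne')
    refine h.congr_deriv ?_
    have hs := Real.sqrt_pos.2 hX
    have hsq := Real.sq_sqrt hX.le
    simp only [zero_smul, add_zero]
    field_simp
    rw [hsq]
    ring
  have hfun : (fun t : ℝ => pfFormEval (X + t • w) u) = fun t : ℝ =>
      (((2 : ℝ) ^ (2 * m / 2) * (Nat.factorial (2 * m / 2) : ℝ))⁻¹ * ((2 : ℝ) ^ (2 * m / 2))⁻¹) *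
      ((Real.sqrt (X + t • w).det)⁻¹ * ∑ τ : Equiv.Perm (Fin (2 * m)),
      ((Equiv.Perm.sign τ : ℤ) : ℝ) * Tf (Mk (X + t • w)⁻¹ (fun j => u (τ j)))) := by
    funext t
    unfold pfFormEval Tf
    rw [Finset.sum_comm]
    simp only [Finset.mul_sum]
    refine Finset.sum_congr rfl fun τ _ => Finset.sum_congr rfl fun π _ => ?_
    simp only [Mk]
    ring
  rw [hfun]
  have hD := (hS.mul (HasDerivAt.fun_sum (u := Finset.univ) fun τ _ =>
    (hT (fun j => u (τ j))).const_mul (((Equiv.Perm.sign (τ : Equiv.Perm (Fin (2*m))) : ℤ) : ℝ)))).const_mul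
    (((2 : ℝ) ^ (2 * m / 2) * (Nat.factorial (2 * m / 2) : ℝ))⁻¹ * ((2 : ℝ) ^ (2 * m / 2))⁻¹)
  refine hD.congr_deriv ?_
  simp only [zero_smul, add_zero, Hf, mul_add, Finset.sum_add_distrib]
  congr 1
  · simp only [Finset.mul_sum]
    exact Finset.sum_congr rfl fun _ _ => by ring
  · ring

/-- The Pfaffian form `φ_X = Pf(dX · X⁻¹ · dX)/√(det X)` on the space of
positive definite symmetric `2m × 2m` real matrices is closed: `dφ = 0`.  The exterior
derivative is expressed pointwise by the standard formula for constant vector fields: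
`(dφ)_X(v₀, …, v_{2m}) = ∑_i (−1)^i ∂_{v_i}[φ(v₀, …, v̂_i, …, v_{2m})](X)`, which must
vanish at every positive definite `X` and all symmetric directions `v_i`. -/
theorem pfForm_closed (m : ℕ) (X : MatN (2 * m)) (hX : X.PosDef)
    (v : Fin (2 * m + 1) → MatN (2 * m)) (hv : ∀ i, (v i).IsSymm) :
    ∑ i : Fin (2 * m + 1), (-1 : ℝ) ^ (i : ℕ) *
      deriv (fun t : ℝ => pfFormEval (X + t • v i) fun j => v (i.succAbove j)) 0 = 0 := by
  have hXs : X.IsSymm := by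
    have := hX.isHermitian
    rwa [Matrix.isHermitian_iff_isSymm] at this
  have hY : (X⁻¹).IsSymm := by
    rw [Matrix.IsSymm, Matrix.transpose_nonsing_inv, hXs.eq]
  have h := alg_identity X⁻¹ hY v hv
  rw [← reindex_sum v (fun z g => Hf X⁻¹ z g)] at h
  simp_rw [fun i => (hasDerivAt_pf X (v i) hX.det_pos fun j => v (i.succAbove j)).deriv,
    mul_left_comm ((-1 : ℝ) ^ _), ← Finset.mul_sum]
  rw [h, mul_zero]

end PF
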